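/- Let λ, μ ∈ ℝ with μ > 0 and λ + μ > 0, set α := (λ+μ)/(λ+3μ) and c := −(λ+μ)/(λ+3μ), let ρ > 0 and let k ≥ 2 be an integer. Let g(x) = ( r^k cos(kθ) − kα(r²−ρ²) r^{k−2} cos((k−2)θ), r^k sin(kθ) + kα(r²−ρ²) r^{k−2} sin((k−2)θ) ) and p(x) = (r^{−k} cos(kθ), r^{−k} sin(kθ)) in polar coordinates. Then for every x with ‖x‖ = ρ, with ν := x/ρ: (i) g(x) = ρ^{2k} p(x), and (ii) [λ(∇·g)ν + μ(∇g + (∇g)ᵀ)ν](x) = c ρ^{2k} [λ(∇·p)ν + μ(∇p + (∇p)ᵀ)ν](x). -/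

import Mathlib

open Real MeasureTheory

noncomputable section

/-- Partial derivative in the first coordinate direction. -/
def pdx (f : ℝ × ℝ → ℝ) (x : ℝ × ℝ) : ℝ := fderiv ℝ f x (1, 0)

/-- Partial derivative in the second coordinate direction. -/
def pdy (f : ℝ × ℝ → ℝ) (x : ℝ × ℝ) : ℝ := fderiv ℝ f x (0, 1)

/-- Divergence of a planar vector field. -/
def div2 (u : ℝ × ℝ → ℝ × ℝ) (x : ℝ × ℝ) : ℝ :=
  pdx (fun y => (u y).1) x + pdy (fun y => (u y).2) x

/-- Componentwise Laplacian. -/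
def lap2 (f : ℝ × ℝ → ℝ) (x : ℝ × ℝ) : ℝ :=
  pdx (fun y => pdx f y) x + pdy (fun y => pdy f y) x

/-- The Lamé operator  μ Δu + (λ+μ) ∇(∇·u). -/
def lame2 (lam mu : ℝ) (u : ℝ × ℝ → ℝ × ℝ) (x : ℝ × ℝ) : ℝ × ℝ :=
  (mu * lap2 (fun y => (u y).1) x + (lam + mu) * pdx (fun y => div2 u y) x,
   mu * lap2 (fun y => (u y).2) x + (lam + mu) * pdy (fun y => div2 u y) x)

/-- Conormal derivative  λ(∇·u)ν + μ(∇u + (∇u)ᵀ)ν. -/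
def trac (lam mu : ℝ) (u : ℝ × ℝ → ℝ × ℝ) (x ν : ℝ × ℝ) : ℝ × ℝ :=
  (lam * div2 u x * ν.1
      + mu * (2 * pdx (fun y => (u y).1) x * ν.1
        + (pdy (fun y => (u y).1) x + pdx (fun y => (u y).2) x) * ν.2),
   lam * div2 u x * ν.2
      + mu * ((pdy (fun y => (u y).1) x + pdx (fun y => (u y).2) x) * ν.1
        + 2 * pdy (fun y => (u y).2) x * ν.2))

/-- Entries of the symmetric gradient ∇ˢu = (∇u + (∇u)ᵀ)/2. -/
def sg11 (u : ℝ × ℝ → ℝ × ℝ) (x : ℝ × ℝ) : ℝ := pdx (fun y => (u y).1) x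

def sg12 (u : ℝ × ℝ → ℝ × ℝ) (x : ℝ × ℝ) : ℝ :=
  (pdy (fun y => (u y).1) x + pdx (fun y => (u y).2) x) / 2

def sg22 (u : ℝ × ℝ → ℝ × ℝ) (x : ℝ × ℝ) : ℝ := pdy (fun y => (u y).2) x

/-- Frobenius inner product ∇ˢu : ∇ˢv of the symmetric gradients of two fields. -/
def sgFrob (u v : ℝ × ℝ → ℝ × ℝ) (x : ℝ × ℝ) : ℝ :=
  sg11 u x * sg11 v x + 2 * (sg12 u x * sg12 v x) + sg22 u x * sg22 v x

/-- Euclidean norm on ℝ². -/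
def nr (x : ℝ × ℝ) : ℝ := Real.sqrt (x.1 ^ 2 + x.2 ^ 2)

/-- The point of `ℂ` with the given real and imaginary part, as a real-linear map. -/
def toComplex : ℝ × ℝ →L[ℝ] ℂ := Complex.equivRealProdCLM.symm

lemma toComplex_apply (x : ℝ × ℝ) : toComplex x = (x.1 : ℂ) + x.2 * Complex.I :=
  Complex.equivRealProd_symm_apply x

lemma toComplex_injective : Function.Injective toComplex :=
  Complex.equivRealProdCLM.symm.injective

lemma toComplex_smul (a : ℝ) (x : ℝ × ℝ) : toComplex (a • x) = a * toComplex x := by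
  simp

lemma toComplex_polar (r θ : ℝ) :
    toComplex (r * Real.cos θ, r * Real.sin θ) = r * Complex.exp (θ * Complex.I) := by
  rw [toComplex_apply, Complex.exp_mul_I]
  push_cast
  ring

/-- The conjugate of `toComplex`. -/
def toComplexConj : ℝ × ℝ →L[ℝ] ℂ := (Complex.conjCLE : ℂ →L[ℝ] ℂ) ∘L toComplex

lemma toComplexConj_apply (x : ℝ × ℝ) : toComplexConj x = (x.1 : ℂ) - x.2 * Complex.I := by
  simp [toComplexConj, toComplex_apply, sub_eq_add_neg]

lemma toComplexConj_polar (r θ : ℝ) :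
    toComplexConj (r * Real.cos θ, r * Real.sin θ) = r * Complex.exp (-θ * Complex.I) := by
  rw [toComplexConj_apply, Complex.exp_mul_I, Complex.cos_neg, Complex.sin_neg]
  push_cast
  ring

lemma toComplex_mul_conj_polar (r θ : ℝ) :
    toComplex (r * Real.cos θ, r * Real.sin θ)
      * toComplexConj (r * Real.cos θ, r * Real.sin θ) = r ^ 2 := by
  rw [toComplex_polar, toComplexConj_polar, mul_mul_mul_comm, ← Complex.exp_add]
  simp [sq]

lemma exists_polar (y : ℝ × ℝ) :
    ∃ r θ : ℝ, 0 ≤ r ∧ y = (r * Real.cos θ, r * Real.sin θ) := by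
  refine ⟨‖toComplex y‖, Complex.arg (toComplex y), norm_nonneg _, ?_⟩
  apply toComplex_injective
  rw [toComplex_polar, Complex.norm_mul_exp_arg_mul_I]

/-- In complex notation the conormal derivative is
`2 (λ + μ) Re (∂_z u) ν + 2 μ (∂_{z̄} u) ν̄`. -/
lemma toComplex_trac (lam mu : ℝ) {u : ℝ × ℝ → ℝ × ℝ} {x : ℝ × ℝ} {a b : ℂ}
    (h : HasFDerivAt (fun y => toComplex (u y)) (a • toComplex + b • toComplexConj) x)
    (ν : ℝ × ℝ) :
    toComplex (trac lam mu u x ν)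
      = 2 * (lam + mu) * (a.re : ℂ) * toComplex ν + 2 * mu * b * toComplexConj ν := by
  have h1 : HasFDerivAt (fun y => (u y).1)
      (Complex.reCLM ∘L (a • toComplex + b • toComplexConj)) x := by
    simpa [Function.comp_def, toComplex_apply] using Complex.reCLM.hasFDerivAt.comp x h
  have h2 : HasFDerivAt (fun y => (u y).2)
      (Complex.imCLM ∘L (a • toComplex + b • toComplexConj)) x := by
    simpa [Function.comp_def, toComplex_apply] using Complex.imCLM.hasFDerivAt.comp x h
  simp only [trac, div2, pdx, pdy, h1.fderiv, h2.fderiv]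
  apply Complex.ext <;> simp [toComplex_apply, toComplexConj_apply] <;> ring

/-- across the circle ‖x‖ = ρ, the interior field g and the exterior field ρ^{2k}p
of the core-type perfect plasmon elastic wave are continuous, and the conormal derivative of g
equals c ρ^{2k} times that of p, where c = −(λ+μ)/(λ+3μ). -/
theorem core_plasmon_wave_transmission_conditions (lam mu : ℝ) (hmu : 0 < mu)
    (hlm : 0 < lam + mu) (α c : ℝ) (hα : α = (lam + mu) / (lam + 3 * mu))
    (hc : c = -((lam + mu) / (lam + 3 * mu)))
    (ρ : ℝ) (hρ : 0 < ρ) (k : ℕ) (hk : 2 ≤ k)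
    (g p : ℝ × ℝ → ℝ × ℝ)
    (hg : ∀ r θ : ℝ, 0 ≤ r →
      g (r * Real.cos θ, r * Real.sin θ)
        = (r ^ k * Real.cos ((k : ℝ) * θ)
              - (k : ℝ) * α * (r ^ 2 - ρ ^ 2) * r ^ (k - 2) * Real.cos (((k : ℝ) - 2) * θ),
           r ^ k * Real.sin ((k : ℝ) * θ)
              + (k : ℝ) * α * (r ^ 2 - ρ ^ 2) * r ^ (k - 2) * Real.sin (((k : ℝ) - 2) * θ)))
    (hp : ∀ r θ : ℝ, 0 < r →
      p (r * Real.cos θ, r * Real.sin θ)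
        = (Real.cos ((k : ℝ) * θ) / r ^ k, Real.sin ((k : ℝ) * θ) / r ^ k)) :
    ∀ θ : ℝ,
      g (ρ * Real.cos θ, ρ * Real.sin θ) = ρ ^ (2 * k) • p (ρ * Real.cos θ, ρ * Real.sin θ)
      ∧ trac lam mu g (ρ * Real.cos θ, ρ * Real.sin θ) (Real.cos θ, Real.sin θ)
          = (c * ρ ^ (2 * k))
              • trac lam mu p (ρ * Real.cos θ, ρ * Real.sin θ) (Real.cos θ, Real.sin θ) := by
  have hg' : ∀ y, toComplex (g y) = toComplex y ^ k
      - k * α * (toComplex y * toComplexConj y - ρ ^ 2) * toComplexConj y ^ (k - 2) := by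
    intro y
    obtain ⟨r, θ, hr, rfl⟩ := exists_polar y
    rw [hg r θ hr, toComplex_mul_conj_polar, toComplex_polar, toComplexConj_polar, toComplex_apply,
      mul_pow, mul_pow, ← Complex.exp_nat_mul, ← Complex.exp_nat_mul, Nat.cast_sub hk,
      show (k : ℂ) * (θ * Complex.I) = (k * θ : ℂ) * Complex.I by ring,
      show ((k : ℂ) - (2 : ℕ)) * (-θ * Complex.I) = -((k - 2) * θ : ℂ) * Complex.I by
        push_cast; ring,
      Complex.exp_mul_I, Complex.exp_mul_I, Complex.cos_neg, Complex.sin_neg]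
    push_cast
    ring
  have hp' : ∀ y, y ≠ 0 → toComplex (p y) = (toComplexConj y ^ k)⁻¹ := by
    intro y hy
    obtain ⟨r, θ, hr, rfl⟩ := exists_polar y
    have hr0 : r ≠ 0 := by
      rintro rfl
      simp at hy
    rw [hp r θ (lt_of_le_of_ne hr hr0.symm), toComplexConj_polar, toComplex_apply, mul_pow,
      mul_inv, ← Complex.exp_nat_mul, ← Complex.exp_neg,
      show -((k : ℂ) * (-θ * Complex.I)) = (k * θ : ℂ) * Complex.I by ring, Complex.exp_mul_I]
    push_cast
    ring
  intro θ
  set x : ℝ × ℝ := (ρ * Real.cos θ, ρ * Real.sin θ) with hx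
  have hρC : (ρ : ℂ) ≠ 0 := by exact_mod_cast hρ.ne'
  have hzw : toComplex x * toComplexConj x = ρ ^ 2 := toComplex_mul_conj_polar ρ θ
  have hw0 : toComplexConj x ≠ 0 := right_ne_zero_of_mul (hzw ▸ pow_ne_zero 2 hρC)
  have hx0 : x ≠ 0 := by
    intro h
    simp [h] at hw0
  have hwinv : (toComplexConj x)⁻¹ = toComplex x / ρ ^ 2 := by
    rw [← hzw]
    field_simp [left_ne_zero_of_mul (hzw ▸ pow_ne_zero 2 hρC)]
  constructor
  · apply toComplex_injective
    rw [toComplex_smul, hg', hp' x hx0, hzw, ← inv_pow, hwinv, div_pow, ← pow_mul]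
    push_cast
    field_simp
    ring
  have hz : HasFDerivAt toComplex toComplex x := toComplex.hasFDerivAt
  have hw : HasFDerivAt toComplexConj toComplexConj x := toComplexConj.hasFDerivAt
  obtain ⟨n, rfl⟩ := Nat.exists_eq_add_of_le' hk
  have hG : HasFDerivAt (fun y => toComplex (g y))
      (((n + 2) * (toComplex x ^ (n + 1) - α * toComplexConj x ^ (n + 1)) : ℂ) • toComplex
        + (-((n + 2) * α * toComplex x * toComplexConj x ^ n) : ℂ) • toComplexConj) x := by
    refine (((hz.pow (n + 2)).sub ((((hz.mul hw).sub_const ((ρ : ℂ) ^ 2)).const_mul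
      ((n + 2 : ℕ) * α : ℂ)).mul (hw.pow n))).congr_of_eventuallyEq
      (Filter.Eventually.of_forall hg')).congr_fderiv ?_
    refine ContinuousLinearMap.ext fun v => ?_
    simp [hzw]
    ring
  have hP : HasFDerivAt (fun y => toComplex (p y))
      ((0 : ℂ) • toComplex
        + (-((n + 2) * (toComplex x / ρ ^ 2) ^ (n + 3)) : ℂ) • toComplexConj) x := by
    refine (((hasDerivAt_inv (pow_ne_zero (n + 2) hw0)).hasFDerivAt.restrictScalars ℝ |>.comp x
      (hw.pow (n + 2))).congr_of_eventuallyEq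
      ((isOpen_ne.eventually_mem hx0).mono hp')).congr_fderiv ?_
    rw [← hwinv]
    refine ContinuousLinearMap.ext fun v => ?_
    simp
    field_simp
    ring
  have hν : x = ρ • (Real.cos θ, Real.sin θ) := by simp [hx]
  have hνz : toComplex (Real.cos θ, Real.sin θ) = toComplex x / ρ := by
    rw [hν, toComplex_smul]
    field_simp
  have hνw : toComplexConj (Real.cos θ, Real.sin θ) = toComplexConj x / ρ := by
    rw [hν, map_smul, Complex.real_smul]
    field_simp
  have hre : ((((n + 2) * (toComplex x ^ (n + 1) - α * toComplexConj x ^ (n + 1)) : ℂ).re : ℝ) : ℂ)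
      = (n + 2) * (1 - α) * (toComplex x ^ (n + 1) + toComplexConj x ^ (n + 1)) / 2 := by
    have hconj : (starRingEnd ℂ) (toComplex x) = toComplexConj x := rfl
    have hconj' : (starRingEnd ℂ) (toComplexConj x) = toComplex x := by
      rw [← hconj, Complex.conj_conj]
    rw [Complex.re_eq_add_conj]
    simp only [map_mul, map_add, map_sub, map_pow, map_natCast, map_ofNat, Complex.conj_ofReal,
      hconj, hconj']
    ring
  have hlame : ((lam : ℂ) + mu) * (1 - α) = 2 * mu * α := by
    have : (lam + mu) * (1 - α) = 2 * mu * α := by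
      have hα' := (eq_div_iff (by linarith : lam + 3 * mu ≠ 0)).mp hα
      linear_combination -hα'
    exact_mod_cast this
  apply toComplex_injective
  rw [toComplex_smul, toComplex_trac lam mu hG, toComplex_trac lam mu hP, hre, hνz, hνw, Complex.zero_re,
    show c = -α by rw [hc, hα]]
  push_cast
  generalize toComplex x = z at *
  generalize toComplexConj x = w at *
  have hright : (ρ : ℂ) ^ (2 * (n + 2)) * (z / ρ ^ 2) ^ (n + 3) * w = z ^ (n + 2) := by
    rw [div_pow, ← pow_mul, show 2 * (n + 3) = 2 * (n + 2) + 2 by ring,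
      pow_add (ρ : ℂ), pow_succ z (n + 2)]
    have hR : (ρ : ℂ) ^ (2 * (n + 2)) ≠ 0 := pow_ne_zero _ hρC
    generalize (ρ : ℂ) ^ (2 * (n + 2)) = R at hR ⊢
    field_simp
    linear_combination z ^ (n + 2) * hzw
  linear_combination (n + 2) * (z ^ (n + 1) + w ^ (n + 1)) * z / ρ * hlame
    - 2 * mu * α * (n + 2) / ρ * hright
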